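/- Let n ≥ 2, s ∈ (0,1), γ₀ > −n, γ ∈ (−n, γ₀], and q > 2. Assume f : ℝⁿ → [0,∞) is measurable and satisfies: the mass bound m₀ ≤ ∫_{ℝⁿ} f(v) dv ≤ M₀; the pressure lower bound inf_{σ ∈ S^{n-1}} sup_{e ∈ S^{n-1}, e ⊥ σ} ∫_{ℝⁿ} f(v̄ + w) |w·e|² dw ≥ p₀ > 0, where v̄ := (∫_{ℝⁿ} f(v) v dv)/(∫_{ℝⁿ} f(v) dv); and the moment bound ∫_{ℝⁿ} f(v) |v|^q dv ≤ M_q. Then there exists c > 0, depending only on n, m₀, M₀, p₀, M_q, q, and γ₀ (in particular independent of s and of v), such that for every v ∈ ℝⁿ and every e ∈ S^{n-1}: ∫_{ℝⁿ} f(w) · (1 − ((w−v)·e)²/|w−v|²) · |w−v|^{γ+2s} dw ≥ c (1 + |v − v̄|)^{γ+2s−2}. -/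

import Mathlib

open MeasureTheory Metric Set
open scoped ENNReal RealInnerProductSpace NNReal

noncomputable section

/-- `ℝⁿ` -/
abbrev En (n : ℕ) := EuclideanSpace ℝ (Fin n)

/-- The mean velocity `v̄ = (∫ f v dv) / (∫ f dv)`. -/
def vbar {n : ℕ} (f : En n → ℝ) : En n := (∫ v, f v)⁻¹ • ∫ v, f v • v

/-- Mass bounds `m₀ ≤ ∫ f ≤ M₀`. -/
def MassBound {n : ℕ} (f : En n → ℝ) (m₀ M₀ : ℝ) : Prop :=
  ENNReal.ofReal m₀ ≤ (∫⁻ v, ENNReal.ofReal (f v)) ∧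
    (∫⁻ v, ENNReal.ofReal (f v)) ≤ ENNReal.ofReal M₀

/-- Pressure lower bound:
`inf_{σ ∈ S^{n-1}} sup_{e ∈ S^{n-1}, e ⊥ σ} ∫ f(v̄+w) |w·e|² dw ≥ p₀`,
written via the ε-characterization of the supremum. -/
def PressureLB {n : ℕ} (f : En n → ℝ) (p₀ : ℝ) : Prop :=
  ∀ σ : En n, ‖σ‖ = 1 → ∀ ε : ℝ, 0 < ε → ∃ e : En n, ‖e‖ = 1 ∧ ⟪e, σ⟫ = 0 ∧
    ENNReal.ofReal (p₀ - ε) ≤ ∫⁻ w, ENNReal.ofReal (f (vbar f + w) * ⟪w, e⟫ ^ 2)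

/-- Moment bound `∫ f(v) |v|^q dv ≤ M_q`. -/
def MomentBound {n : ℕ} (f : En n → ℝ) (q Mq : ℝ) : Prop :=
  (∫⁻ v, ENNReal.ofReal (f v * ‖v‖ ^ q)) ≤ ENNReal.ofReal Mq

/-- Bessel's inequality for an orthonormal pair. -/
lemma inner_sq_add_inner_sq_le {E : Type*} [NormedAddCommGroup E] [InnerProductSpace ℝ E]
    {e e' : E} (he : ‖e‖ = 1) (he' : ‖e'‖ = 1) (h : ⟪e', e⟫ = 0) (z : E) :
    ⟪z, e⟫ ^ 2 + ⟪z, e'⟫ ^ 2 ≤ ‖z‖ ^ 2 := by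
  have h0 : 0 ≤ ‖z - (⟪z, e⟫ • e + ⟪z, e'⟫ • e')‖ ^ 2 := by positivity
  rw [norm_sub_sq_real, norm_add_sq_real, norm_smul, norm_smul, inner_add_right,
    inner_smul_right, inner_smul_right, inner_smul_left, inner_smul_right,
    real_inner_comm e' e, h, he, he'] at h0
  simp only [Real.norm_eq_abs, mul_one, sq_abs, mul_zero, add_zero] at h0
  nlinarith

/-- The squared sine of the angle between `z` and `e` dominates the normalized square of the
component of `z` along any unit vector orthogonal to `e`. -/
lemma inner_sq_mul_rpow_le_sin_sq_mul_rpow {E : Type*} [NormedAddCommGroup E]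
    [InnerProductSpace ℝ E] {e e' z : E} (he : ‖e‖ = 1) (he' : ‖e'‖ = 1) (h : ⟪e', e⟫ = 0)
    (hz : 0 < ‖z‖) (α : ℝ) :
    ⟪z, e'⟫ ^ 2 * ‖z‖ ^ (α - 2) ≤ (1 - ⟪z, e⟫ ^ 2 / ‖z‖ ^ 2) * ‖z‖ ^ α := by
  have hα : ‖z‖ ^ α = ‖z‖ ^ 2 * ‖z‖ ^ (α - 2) := by
    rw [← Real.rpow_natCast, ← Real.rpow_add hz]
    norm_num
  have hsin : (1 - ⟪z, e⟫ ^ 2 / ‖z‖ ^ 2) * ‖z‖ ^ 2 = ‖z‖ ^ 2 - ⟪z, e⟫ ^ 2 := by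
    field_simp
  rw [hα, ← mul_assoc, hsin]
  gcongr
  linarith [inner_sq_add_inner_sq_le he he' h z]

/-- A lower bound for `x ^ β`, uniform for `x ∈ [κ, L]` and `β ∈ [-N, G]`. -/
lemma min_rpow_le_rpow {κ L G N x β : ℝ} (hκ : 0 < κ) (hκ1 : κ ≤ 1) (hL : 1 ≤ L)
    (hβG : β ≤ G) (hNβ : -N ≤ β) (hκx : κ ≤ x) (hxL : x ≤ L) :
    min (κ ^ G) (L ^ (-N)) ≤ x ^ β := by
  rcases le_total 0 β with hβ | hβ
  · exact (min_le_left _ _).trans <|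
      (Real.rpow_le_rpow_of_exponent_ge hκ hκ1 hβG).trans (Real.rpow_le_rpow hκ.le hκx hβ)
  · exact (min_le_right _ _).trans <|
      (Real.rpow_le_rpow_of_exponent_le hL hNβ).trans
        (Real.rpow_le_rpow_of_nonpos (hκ.trans_le hκx) hxL hβ)

/-- Lower powers are controlled by the mass and a higher power. -/
lemma pow_le_one_add_rpow {x q : ℝ} (hx : 0 ≤ x) (k : ℕ) (hkq : (k : ℝ) ≤ q) :
    x ^ k ≤ 1 + x ^ q := by
  have hq : 0 ≤ x ^ q := Real.rpow_nonneg hx q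
  rcases le_total x 1 with h | h
  · linarith [pow_le_one₀ (n := k) hx h]
  · rw [← Real.rpow_natCast]
    linarith [Real.rpow_le_rpow_of_exponent_le h hkq]

lemma integrable_and_integral_le_of_lintegral_le {α : Type*} [MeasurableSpace α] {μ : Measure α}
    {g : α → ℝ} (hg : Measurable g) (hg0 : ∀ x, 0 ≤ g x) {M : ℝ}
    (h : (∫⁻ x, ENNReal.ofReal (g x) ∂μ) ≤ ENNReal.ofReal M) :
    Integrable g μ ∧ ∫ x, g x ∂μ ≤ max M 0 := by
  constructor
  · refine ⟨hg.aestronglyMeasurable, ?_⟩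
    rw [hasFiniteIntegral_iff_ofReal (Filter.Eventually.of_forall hg0)]
    exact h.trans_lt ENNReal.ofReal_lt_top
  · rw [integral_eq_lintegral_of_nonneg_ae (Filter.Eventually.of_forall hg0)
      hg.aestronglyMeasurable]
    exact (ENNReal.toReal_mono ENNReal.ofReal_ne_top h).trans_eq ENNReal.toReal_ofReal'

lemma integrable_mul_norm_pow {n : ℕ} {f : En n → ℝ} (hf : Measurable f) (hf0 : ∀ v, 0 ≤ f v)
    {q : ℝ} (hint : Integrable f) (hq : Integrable fun v => f v * ‖v‖ ^ q) (k : ℕ)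
    (hkq : (k : ℝ) ≤ q) : Integrable fun v => f v * ‖v‖ ^ k := by
  refine (hint.add hq).mono' (by fun_prop) (Filter.Eventually.of_forall fun v => ?_)
  rw [Real.norm_of_nonneg (mul_nonneg (hf0 v) (by positivity))]
  change f v * ‖v‖ ^ k ≤ f v + f v * ‖v‖ ^ q
  nlinarith [mul_le_mul_of_nonneg_left (pow_le_one_add_rpow (norm_nonneg v) k hkq) (hf0 v)]

/-- A density with finite `q`-th moment, `q ≥ 1`, has bounded mean velocity. -/
lemma norm_vbar_le {n : ℕ} {f : En n → ℝ} (hf0 : ∀ v, 0 ≤ f v)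
    {q m₀ A B : ℝ} (hq1 : 1 ≤ q) (hm₀ : 0 < m₀) (hint : Integrable f)
    (hq : Integrable fun v => f v * ‖v‖ ^ q) (hm : m₀ ≤ ∫ v, f v) (hA : ∫ v, f v ≤ A)
    (hB : ∫ v, f v * ‖v‖ ^ q ≤ B) : ‖vbar f‖ ≤ m₀⁻¹ * (A + B) := by
  have h1 : ‖∫ v, f v • v‖ ≤ A + B := by
    have hsum : ∫ v, (f v + f v * ‖v‖ ^ q) = (∫ v, f v) + ∫ v, f v * ‖v‖ ^ q :=
      integral_add hint hq
    refine (norm_integral_le_of_norm_le (hint.add hq)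
      (Filter.Eventually.of_forall fun v => ?_)).trans (hsum.le.trans (add_le_add hA hB))
    rw [norm_smul, Real.norm_of_nonneg (hf0 v)]
    have := pow_le_one_add_rpow (norm_nonneg v) 1 (by simpa using hq1)
    change f v * ‖v‖ ≤ f v + f v * ‖v‖ ^ q
    nlinarith [mul_le_mul_of_nonneg_left this (hf0 v)]
  rw [vbar, norm_smul, norm_inv, Real.norm_of_nonneg (hm₀.le.trans hm)]
  gcongr

/-- The second moment in direction `e'` about an arbitrary point is the centred one plus the
contribution of the displacement. -/
lemma integrable_and_integral_inner_sub_sq {n : ℕ} {f : En n → ℝ} (hf : Measurable f)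
    (hf0 : ∀ v, 0 ≤ f v) (hint : Integrable f) (h1 : Integrable fun v => f v * ‖v‖ ^ 1)
    (h2 : Integrable fun v => f v * ‖v‖ ^ 2) (hpos : 0 < ∫ v, f v) (v e' : En n) :
    (Integrable fun w => f w * ⟪w - v, e'⟫ ^ 2) ∧
      ∫ w, f w * ⟪w - v, e'⟫ ^ 2 =
        (∫ w, f w * ⟪w - vbar f, e'⟫ ^ 2) + ⟪v - vbar f, e'⟫ ^ 2 * ∫ w, f w := by
  have hvec : Integrable fun w => f w • w := by
    refine h1.mono' (by fun_prop) (Filter.Eventually.of_forall fun w => ?_)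
    rw [norm_smul, Real.norm_of_nonneg (hf0 w), pow_one]
  have hlin : Integrable fun w => f w * ⟪w, e'⟫ := by
    refine (hvec.inner_const e').congr (Filter.Eventually.of_forall fun w => ?_)
    simp [inner_smul_left]
  have hquad : Integrable fun w => f w * ⟪w, e'⟫ ^ 2 := by
    refine (h2.mul_const (‖e'‖ ^ 2)).mono' (by fun_prop) (Filter.Eventually.of_forall fun w => ?_)
    rw [Real.norm_of_nonneg (mul_nonneg (hf0 w) (by positivity)), mul_assoc, ← mul_pow]
    refine mul_le_mul_of_nonneg_left ?_ (hf0 w)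
    exact sq_le_sq' (by linarith [neg_le_of_abs_le (abs_real_inner_le_norm w e')])
      (real_inner_le_norm w e')
  have hmean : ∫ w, f w * ⟪w, e'⟫ = ⟪vbar f, e'⟫ * ∫ w, f w := by
    have h := integral_inner (𝕜 := ℝ) hvec e'
    simp only [real_inner_comm _ e', inner_smul_left, conj_trivial] at h
    rw [vbar, inner_smul_left, conj_trivial, ← h]
    field_simp
  have hexp (b : En n) : (fun w => f w * ⟪w - b, e'⟫ ^ 2) = fun w =>
      f w * ⟪w, e'⟫ ^ 2 - 2 * ⟪b, e'⟫ * (f w * ⟪w, e'⟫) + ⟪b, e'⟫ ^ 2 * f w := by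
    ext w
    rw [inner_sub_left]
    ring
  have hval (b : En n) : ∫ w, f w * ⟪w - b, e'⟫ ^ 2 = (∫ w, f w * ⟪w, e'⟫ ^ 2)
      - 2 * ⟪b, e'⟫ * (⟪vbar f, e'⟫ * ∫ w, f w) + ⟪b, e'⟫ ^ 2 * ∫ w, f w := by
    have hadd : ∫ w, (f w * ⟪w, e'⟫ ^ 2 - 2 * ⟪b, e'⟫ * (f w * ⟪w, e'⟫) + ⟪b, e'⟫ ^ 2 * f w) =
        (∫ w, (f w * ⟪w, e'⟫ ^ 2 - 2 * ⟪b, e'⟫ * (f w * ⟪w, e'⟫))) + ∫ w, ⟪b, e'⟫ ^ 2 * f w :=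
      integral_add (hquad.sub (hlin.const_mul _)) (hint.const_mul _)
    rw [hexp, hadd, integral_sub hquad (hlin.const_mul _), integral_const_mul,
      integral_const_mul, hmean]
  refine ⟨?_, ?_⟩
  · rw [hexp]
    exact (hquad.sub (hlin.const_mul _)).add (hint.const_mul _)
  · rw [hval, hval, inner_sub_left]
    ring

/-- Off the truncation region `‖w‖ ≤ R`, `κ (1 + ‖v - b‖) ≤ ‖w - v‖`, the quadratic weight
is bounded by a small constant plus a small multiple of the `q`-th power. -/
lemma inner_sub_sq_le_of_not_mem {E : Type*} [NormedAddCommGroup E] [InnerProductSpace ℝ E]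
    {R r q : ℝ} (hR : 1 ≤ R) (hr : 0 < r) (hr1 : r ≤ 1) (hq : 2 < q) {b e' : E} (hb : ‖b‖ ≤ R)
    (he' : ‖e'‖ = 1) (v w : E) (hw : ¬ (‖w‖ ≤ R ∧ r / (1 + 4 * R) * (1 + ‖v - b‖) ≤ ‖w - v‖)) :
    ⟪w - v, e'⟫ ^ 2 ≤ r ^ 2 + 8 * (1 + ⟪v - b, e'⟫ ^ 2) * R ^ (2 - q) * ‖w‖ ^ q := by
  have hR0 : 0 < R := by linarith
  have hcs (z : E) : ⟪z, e'⟫ ^ 2 ≤ ‖z‖ ^ 2 := by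
    have := abs_real_inner_le_norm z e'
    rw [he', mul_one] at this
    exact sq_le_sq.2 (by rwa [abs_norm])
  by_cases hwR : ‖w‖ ≤ R
  · have hlt : ‖w - v‖ < r / (1 + 4 * R) * (1 + ‖v - b‖) := by
      by_contra! h
      exact hw ⟨hwR, h⟩
    have hrest : 0 ≤ 8 * (1 + ⟪v - b, e'⟫ ^ 2) * R ^ (2 - q) * ‖w‖ ^ q := by positivity
    have htri : ‖v - b‖ ≤ ‖w - v‖ + ‖w - b‖ := by
      rw [← norm_neg (w - v)]
      exact (norm_sub_le_norm_sub_add_norm_sub v w b).trans_eq (by rw [neg_sub])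
    have hwb : ‖w - b‖ ≤ 2 * R := (norm_sub_le _ _).trans (by linarith)
    rw [div_mul_eq_mul_div, lt_div_iff₀ (by positivity)] at hlt
    have hle : ‖w - v‖ ≤ r := by
      by_cases hV : ‖v - b‖ ≤ 4 * R
      · nlinarith [norm_nonneg (w - v)]
      · push Not at hV
        exfalso
        nlinarith [norm_nonneg (w - v), norm_nonneg (v - b)]
    nlinarith [hcs (w - v), norm_nonneg (w - v)]
  · push Not at hwR
    have hsplit : ⟪w - v, e'⟫ = ⟪w - b, e'⟫ - ⟪v - b, e'⟫ := by
      rw [← inner_sub_left, sub_sub_sub_cancel_right]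
    have hwb : ‖w - b‖ ≤ 2 * ‖w‖ := (norm_sub_le _ _).trans (by linarith)
    have hx : ⟪w - b, e'⟫ ^ 2 ≤ 4 * ‖w‖ ^ 2 := by
      nlinarith [hcs (w - b), norm_nonneg (w - b)]
    have hpow : ‖w‖ ^ 2 ≤ R ^ (2 - q) * ‖w‖ ^ q := by
      have hw0 : 0 < ‖w‖ := hR0.trans hwR
      have : ‖w‖ ^ 2 = ‖w‖ ^ (2 - q) * ‖w‖ ^ q := by
        rw [← Real.rpow_add hw0, ← Real.rpow_natCast]
        norm_num
      rw [this]
      exact mul_le_mul_of_nonneg_right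
        (Real.rpow_le_rpow_of_nonpos hR0 hwR.le (by linarith)) (by positivity)
    have hw1 : 1 ≤ ‖w‖ ^ 2 := by nlinarith
    have hmul := mul_le_mul_of_nonneg_left hpow
      (show 0 ≤ 8 * (1 + ⟪v - b, e'⟫ ^ 2) by positivity)
    rw [hsplit]
    nlinarith [sq_nonneg (⟪w - b, e'⟫ + ⟪v - b, e'⟫), sq_nonneg r, sq_nonneg ⟪v - b, e'⟫,
      mul_le_mul_of_nonneg_left hw1 (sq_nonneg ⟪v - b, e'⟫)]

/-- A truncation radius beyond which the `q`-th moments are negligible. -/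
lemma exists_radius {q δ : ℝ} (hq : 2 < q) (hδ : 0 < δ) (B K : ℝ) :
    ∃ R : ℝ, 1 ≤ R ∧ K ≤ R ∧ 8 * R ^ (2 - q) * B ≤ δ := by
  have hlim : Filter.Tendsto (fun R : ℝ => 8 * R ^ (2 - q) * B) Filter.atTop (nhds 0) := by
    have := ((tendsto_rpow_neg_atTop (sub_pos.2 hq)).const_mul 8).mul_const B
    simpa using this
  obtain ⟨R, h, h1, hK⟩ := ((hlim.eventually_le_const hδ).and
    ((Filter.eventually_ge_atTop 1).and (Filter.eventually_ge_atTop K))).exists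
  exact ⟨R, h1, hK, h⟩

/-- Uniform nondegeneracy of the truncated second moment: the region close to `v` and the region
far from the origin carry only part of the directional pressure. -/
lemma le_setIntegral_inner_sub_sq {n : ℕ} {f : En n → ℝ} (hf : Measurable f)
    (hf0 : ∀ v, 0 ≤ f v) {q m₀ p₀ A B R r : ℝ} (hq : 2 < q) (hm₀ : 0 < m₀) (hint : Integrable f)
    (hqint : Integrable fun v => f v * ‖v‖ ^ q) (hm : m₀ ≤ ∫ v, f v) (hA : ∫ v, f v ≤ A)
    (hB : ∫ v, f v * ‖v‖ ^ q ≤ B) (hR : 1 ≤ R) (hr : 0 < r) (hr1 : r ≤ 1)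
    (hvR : ‖vbar f‖ ≤ R) (hRm : 8 * R ^ (2 - q) * B ≤ m₀) (hRp : 8 * R ^ (2 - q) * B ≤ p₀ / 4)
    (hrp : r ^ 2 * A ≤ p₀ / 4) {e' : En n} (he' : ‖e'‖ = 1)
    (hP : p₀ - p₀ / 4 ≤ ∫ w, f w * ⟪w - vbar f, e'⟫ ^ 2) (v : En n) :
    (Integrable fun w => f w * ⟪w - v, e'⟫ ^ 2) ∧ p₀ / 4 ≤
      ∫ w in {w | ‖w‖ ≤ R ∧ r / (1 + 4 * R) * (1 + ‖v - vbar f‖) ≤ ‖w - v‖},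
        f w * ⟪w - v, e'⟫ ^ 2 := by
  obtain ⟨hi, hexp⟩ := integrable_and_integral_inner_sub_sq hf hf0 hint
    (integrable_mul_norm_pow hf hf0 hint hqint 1 (by norm_num; linarith))
    (integrable_mul_norm_pow hf hf0 hint hqint 2 (by norm_num; linarith)) (hm₀.trans_le hm) v e'
  refine ⟨hi, ?_⟩
  set T := {w : En n | ‖w‖ ≤ R ∧ r / (1 + 4 * R) * (1 + ‖v - vbar f‖) ≤ ‖w - v‖}
  have hT : MeasurableSet T := by measurability
  set a := ⟪v - vbar f, e'⟫
  have hRpow : 0 < R ^ (2 - q) := Real.rpow_pos_of_pos (by linarith) _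
  have hcompl : ∫ w in Tᶜ, f w * ⟪w - v, e'⟫ ^ 2 ≤
      r ^ 2 * A + 8 * (1 + a ^ 2) * R ^ (2 - q) * B := by
    have hdom : Integrable fun w =>
        r ^ 2 * f w + 8 * (1 + a ^ 2) * R ^ (2 - q) * (f w * ‖w‖ ^ q) :=
      (hint.const_mul _).add (hqint.const_mul _)
    calc ∫ w in Tᶜ, f w * ⟪w - v, e'⟫ ^ 2
        ≤ ∫ w in Tᶜ, (r ^ 2 * f w + 8 * (1 + a ^ 2) * R ^ (2 - q) * (f w * ‖w‖ ^ q)) := by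
          refine setIntegral_mono_on hi.integrableOn hdom.integrableOn hT.compl fun w hw => ?_
          have := mul_le_mul_of_nonneg_left
            (inner_sub_sq_le_of_not_mem hR hr hr1 hq hvR he' v w hw) (hf0 w)
          exact this.trans_eq (by ring)
      _ ≤ ∫ w, (r ^ 2 * f w + 8 * (1 + a ^ 2) * R ^ (2 - q) * (f w * ‖w‖ ^ q)) := by
          refine setIntegral_le_integral hdom (Filter.Eventually.of_forall fun w => ?_)
          have := hf0 w
          change 0 ≤ r ^ 2 * f w + 8 * (1 + a ^ 2) * R ^ (2 - q) * (f w * ‖w‖ ^ q)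
          positivity
      _ = r ^ 2 * (∫ w, f w) + 8 * (1 + a ^ 2) * R ^ (2 - q) * ∫ w, f w * ‖w‖ ^ q := by
          rw [integral_add (hint.const_mul _) (hqint.const_mul _), integral_const_mul,
            integral_const_mul]
      _ ≤ _ := by gcongr
  have hsplit := integral_add_compl hT hi
  nlinarith [mul_le_mul_of_nonneg_left hm (sq_nonneg a),
    mul_le_mul_of_nonneg_left hRm (sq_nonneg a)]

/-- nondegeneracy in the form \eqref{eq:nondegenerate-goal} of the paper:
under mass, pressure, and `q`-moment bounds (`q > 2`), for all `v ∈ ℝⁿ` and unit `e`,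
`∫ f(w) sin²(w-v, e) |w-v|^{γ+2s} dw ≥ c (1+|v-v̄|)^{γ+2s-2}`, with `c` depending only on
`n, m₀, M₀, p₀, M_q, q, γ₀` (independent of `s ∈ (0,1)`, `γ ∈ (-n, γ₀]` and `v`). -/
theorem stmt7 (n : ℕ) (hn : 2 ≤ n) (γ₀ m₀ M₀ p₀ Mq q : ℝ)
    (hγ₀ : -(n : ℝ) < γ₀) (hm₀ : 0 < m₀) (hp₀ : 0 < p₀) (hq : 2 < q) :
    ∃ c : ℝ, 0 < c ∧
      ∀ s γ : ℝ, s ∈ Set.Ioo (0:ℝ) 1 → -(n : ℝ) < γ → γ ≤ γ₀ →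
        ∀ f : En n → ℝ, Measurable f → (∀ v, 0 ≤ f v) →
          MassBound f m₀ M₀ → PressureLB f p₀ → MomentBound f q Mq →
          ∀ (v e : En n), ‖e‖ = 1 →
            ENNReal.ofReal (c * (1 + ‖v - vbar f‖) ^ (γ + 2*s - 2)) ≤
              ∫⁻ w, ENNReal.ofReal
                (f w * (1 - ⟪w - v, e⟫ ^ 2 / ‖w - v‖ ^ 2) * ‖w - v‖ ^ (γ + 2*s)) := by
  set A := max M₀ 0
  set B := max Mq 0
  obtain ⟨R, hR, hKR, hRδ⟩ := exists_radius hq (show 0 < min m₀ (p₀ / 4) by positivity) B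
    (m₀⁻¹ * (A + B))
  obtain ⟨r, hr, hr1, hrp⟩ : ∃ r : ℝ, 0 < r ∧ r ≤ 1 ∧ r ^ 2 * A ≤ p₀ / 4 := by
    have hA : 0 ≤ A := le_max_right _ _
    refine ⟨min 1 (p₀ / (4 * (A + 1))), by positivity, min_le_left _ _, ?_⟩
    set r := min 1 (p₀ / (4 * (A + 1)))
    have hr0 : 0 ≤ r := by positivity
    have h1 : r ≤ 1 := min_le_left _ _
    have h2 : r ≤ p₀ / (4 * (A + 1)) := min_le_right _ _
    rw [le_div_iff₀ (by positivity)] at h2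
    nlinarith [mul_nonneg hr0 hA, mul_le_mul_of_nonneg_right h1 (mul_nonneg hr0 hA)]
  set κ := r / (1 + 4 * R)
  have hκ : 0 < κ := by positivity
  have hκ1 : κ ≤ 1 := (div_le_one (by positivity)).2 (by linarith)
  set C := min (κ ^ γ₀) ((2 * R) ^ (-((n : ℝ) + 2)))
  have hC : 0 < C := by positivity
  refine ⟨C * (p₀ / 4), by positivity, ?_⟩
  intro s γ hs hγ hγγ₀ f hf hf0 hmass hpres hmom v e he
  obtain ⟨hint, hA⟩ := integrable_and_integral_le_of_lintegral_le hf hf0 hmass.2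
  obtain ⟨hqint, hB⟩ := integrable_and_integral_le_of_lintegral_le
    (g := fun v => f v * ‖v‖ ^ q) (by fun_prop)
    (fun v => mul_nonneg (hf0 v) (by positivity)) hmom
  have hm : m₀ ≤ ∫ v, f v := by
    have h := hmass.1
    rw [← ofReal_integral_eq_lintegral_ofReal hint (Filter.Eventually.of_forall hf0)] at h
    exact (ENNReal.ofReal_le_ofReal_iff (integral_nonneg hf0)).1 h
  obtain ⟨e', he', hee', hP⟩ := hpres e he (p₀ / 4) (by positivity)
  have hvR : ‖vbar f‖ ≤ R :=
    (norm_vbar_le hf0 (by linarith) hm₀ hint hqint hm hA hB).trans hKR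
  have hP' : p₀ - p₀ / 4 ≤ ∫ w, f w * ⟪w - vbar f, e'⟫ ^ 2 := by
    have hi := (integrable_and_integral_inner_sub_sq hf hf0 hint
      (integrable_mul_norm_pow hf hf0 hint hqint 1 (by norm_num; linarith))
      (integrable_mul_norm_pow hf hf0 hint hqint 2 (by norm_num; linarith))
      (hm₀.trans_le hm) (vbar f) e').1
    have hnn (w : En n) : 0 ≤ f w * ⟪w - vbar f, e'⟫ ^ 2 := mul_nonneg (hf0 w) (sq_nonneg _)
    have htrans := lintegral_add_left_eq_self (μ := volume)
      (fun w => ENNReal.ofReal (f w * ⟪w - vbar f, e'⟫ ^ 2)) (vbar f)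
    simp only [add_sub_cancel_left] at htrans
    rw [htrans, ← ofReal_integral_eq_lintegral_ofReal hi (Filter.Eventually.of_forall hnn)] at hP
    exact (ENNReal.ofReal_le_ofReal_iff (integral_nonneg hnn)).1 hP
  obtain ⟨hi, hT⟩ := le_setIntegral_inner_sub_sq hf hf0 hq hm₀ hint hqint hm hA hB hR hr hr1 hvR
    (hRδ.trans (min_le_left _ _)) (hRδ.trans (min_le_right _ _)) hrp he' hP' v
  set V := ‖v - vbar f‖ with hV
  have hV0 : 0 ≤ V := norm_nonneg _
  set T := {w : En n | ‖w‖ ≤ R ∧ κ * (1 + V) ≤ ‖w - v‖}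
  have hTm : MeasurableSet T := by measurability
  set D := C * (1 + V) ^ (γ + 2 * s - 2)
  have hD : 0 ≤ D := by positivity
  have hweight : ∀ w ∈ T, D ≤ ‖w - v‖ ^ (γ + 2 * s - 2) := by
    rintro w ⟨hwR, hwκ⟩
    have hup : ‖w - v‖ ≤ 2 * R * (1 + V) := by
      have h1 : ‖w - v‖ ≤ ‖w - vbar f‖ + V := by
        rw [hV, norm_sub_rev v]
        exact norm_sub_le_norm_sub_add_norm_sub _ _ _
      have h2 := norm_sub_le w (vbar f)
      nlinarith
    have h := min_rpow_le_rpow (G := γ₀) (N := (n : ℝ) + 2) (β := γ + 2 * s - 2)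
      (x := ‖w - v‖ / (1 + V)) hκ hκ1 (by linarith : 1 ≤ 2 * R) (by linarith [hs.2])
      (by linarith [hs.1]) ((le_div_iff₀ (by positivity)).2 hwκ)
      ((div_le_iff₀ (by positivity)).2 hup)
    rw [Real.div_rpow (norm_nonneg _) (by positivity)] at h
    exact (le_div_iff₀ (by positivity)).1 h
  calc ENNReal.ofReal (C * (p₀ / 4) * (1 + V) ^ (γ + 2 * s - 2))
      ≤ ENNReal.ofReal (∫ w in T, D * (f w * ⟪w - v, e'⟫ ^ 2)) := by
        refine ENNReal.ofReal_le_ofReal ?_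
        rw [integral_const_mul]
        exact (mul_le_mul_of_nonneg_left hT hD).trans_eq' (by ring)
    _ = ∫⁻ w in T, ENNReal.ofReal (D * (f w * ⟪w - v, e'⟫ ^ 2)) :=
        ofReal_integral_eq_lintegral_ofReal (hi.const_mul D).integrableOn
          (Filter.Eventually.of_forall fun w =>
            mul_nonneg hD (mul_nonneg (hf0 w) (sq_nonneg _)))
    _ ≤ ∫⁻ w in T, ENNReal.ofReal
          (f w * (1 - ⟪w - v, e⟫ ^ 2 / ‖w - v‖ ^ 2) * ‖w - v‖ ^ (γ + 2*s)) := by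
        refine setLIntegral_mono' hTm fun w hw => ENNReal.ofReal_le_ofReal ?_
        have hz : 0 < ‖w - v‖ := lt_of_lt_of_le (by positivity) hw.2
        calc D * (f w * ⟪w - v, e'⟫ ^ 2)
            = f w * (⟪w - v, e'⟫ ^ 2 * D) := by ring
          _ ≤ f w * (⟪w - v, e'⟫ ^ 2 * ‖w - v‖ ^ (γ + 2 * s - 2)) :=
            mul_le_mul_of_nonneg_left
              (mul_le_mul_of_nonneg_left (hweight w hw) (sq_nonneg _)) (hf0 w)
          _ ≤ f w * ((1 - ⟪w - v, e⟫ ^ 2 / ‖w - v‖ ^ 2) * ‖w - v‖ ^ (γ + 2 * s)) :=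
            mul_le_mul_of_nonneg_left
              (inner_sq_mul_rpow_le_sin_sq_mul_rpow he he' hee' hz _) (hf0 w)
          _ = _ := by ring
    _ ≤ _ := setLIntegral_le_lintegral _ _
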